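/- arXiv:2401.04462 — 3 statements merged into one kernel-verified Lean document; each statement's English description precedes it below -/
import Mathlib

section
/- Let d be a natural number with 1 ≤ d and let ε be a real number with 0 ≤ ε < d/2. Define g(x) := (2d − ‖x‖²)/(2^(d+1)·π^(d/2)·Γ(1+d/4+ε/2)) · exp(−‖x‖²/4) and p(x) := ∫₀¹ Λ^(−1+d/2−ε) · g(Λ·x) dΛ. Then ∫_{ℝ^d} g(x)·p(x) dx > 0. -/
/-- The heat-kernel propagator slice `g` of equation (2.11) of the paper. -/
noncomputable def gfun (d : ℕ) (ε : ℝ) (x : EuclideanSpace ℝ (Fin d)) : ℝ :=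
  (2*(d:ℝ) - ‖x‖^2)
    / (2^(d+1) * Real.pi ^ ((d:ℝ)/2) * Real.Gamma (1 + (d:ℝ)/4 + ε/2))
    * Real.exp (-‖x‖^2/4)

/-- The ultraviolet-cutoff propagator `p = ∫₀¹ g_Λ dΛ` of equation (2.7) of the paper. -/
noncomputable def pfun (d : ℕ) (ε : ℝ) (x : EuclideanSpace ℝ (Fin d)) : ℝ :=
  ∫ Λ in (0:ℝ)..1, Λ ^ (-1 + (d:ℝ)/2 - ε) * gfun d ε (Λ • x)

open MeasureTheory Set

lemma continuous_gfun (d : ℕ) (ε : ℝ) : Continuous (gfun d ε) := by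
  unfold gfun
  fun_prop

/-- The half-line Gaussian moment recursion. -/
lemma integral_pow_add_two_mul_exp_neg_mul_sq {b : ℝ} (hb : 0 < b) (k : ℕ) :
    ∫ y in Ioi (0 : ℝ), y ^ (k + 2) * Real.exp (-b * y ^ 2)
      = (k + 1) / (2 * b) * ∫ y in Ioi (0 : ℝ), y ^ k * Real.exp (-b * y ^ 2) := by
  have moment (n : ℕ) : ∫ y in Ioi (0 : ℝ), y ^ n * Real.exp (-b * y ^ 2)
      = b ^ (-((n : ℝ) + 1) / 2) * (1 / 2) * Real.Gamma (((n : ℝ) + 1) / 2) := by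
    rw [← integral_rpow_mul_exp_neg_mul_rpow (p := 2) (q := n) (by norm_num)
      (by have := n.cast_nonneg (α := ℝ); linarith) hb]
    simp only [Real.rpow_natCast, Real.rpow_two]
  rw [moment, moment]
  push_cast
  have hk : ((k : ℝ) + 1) / 2 ≠ 0 := by positivity
  rw [show ((k : ℝ) + 2 + 1) / 2 = (k + 1) / 2 + 1 by ring, Real.Gamma_add_one hk,
    show -((k : ℝ) + 2 + 1) / 2 = -(k + 1) / 2 - 1 by ring, Real.rpow_sub_one hb.ne']
  field_simp

lemma integrable_norm_pow_mul_exp_neg_mul_sq {d : ℕ} (hd : 1 ≤ d) {b : ℝ} (hb : 0 < b) (k : ℕ) :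
    Integrable fun x : EuclideanSpace ℝ (Fin d) => ‖x‖ ^ k * Real.exp (-b * ‖x‖ ^ 2) := by
  have : Nonempty (Fin d) := ⟨⟨0, hd⟩⟩
  rw [integrable_fun_norm_addHaar volume (f := fun y => y ^ k * Real.exp (-b * y ^ 2))]
  have h := (integrable_rpow_mul_exp_neg_mul_sq hb (s := ((d - 1 + k : ℕ) : ℝ))
    (by have := (d - 1 + k).cast_nonneg (α := ℝ); linarith)).integrableOn (s := Ioi 0)
  simpa only [finrank_euclideanSpace_fin, smul_eq_mul, Real.rpow_natCast, pow_add, mul_assoc] using h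

/-- The Gaussian moment recursion for even powers of the Euclidean norm. -/
lemma integral_norm_pow_add_two_mul_exp_neg_mul_sq {d : ℕ} (hd : 1 ≤ d) {b : ℝ} (hb : 0 < b)
    (k : ℕ) :
    ∫ x : EuclideanSpace ℝ (Fin d), ‖x‖ ^ (k + 2) * Real.exp (-b * ‖x‖ ^ 2)
      = (d + k) / (2 * b) *
        ∫ x : EuclideanSpace ℝ (Fin d), ‖x‖ ^ k * Real.exp (-b * ‖x‖ ^ 2) := by
  have : Nonempty (Fin d) := ⟨⟨0, hd⟩⟩
  rw [integral_fun_norm_addHaar volume (f := fun y => y ^ (k + 2) * Real.exp (-b * y ^ 2)),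
    integral_fun_norm_addHaar volume (f := fun y => y ^ k * Real.exp (-b * y ^ 2))]
  have h := integral_pow_add_two_mul_exp_neg_mul_sq hb (d - 1 + k)
  simp only [finrank_euclideanSpace_fin, smul_eq_mul, ← mul_assoc, ← pow_add, nsmul_eq_mul]
  rw [← add_assoc, h]
  push_cast [Nat.cast_sub hd]
  ring

/-- The overlap of `g` with each of its dilates is positive. -/
lemma integral_gfun_mul_gfun_smul_pos {d : ℕ} (hd : 1 ≤ d) {ε : ℝ} (hε : 0 ≤ ε) {l : ℝ}
    (hl : 0 < l) :
    0 < ∫ x : EuclideanSpace ℝ (Fin d), gfun d ε x * gfun d ε (l • x) := by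
  have : Nonempty (Fin d) := ⟨⟨0, hd⟩⟩
  have hd0 : (0 : ℝ) < d := by exact_mod_cast hd
  set c : ℝ := 2 ^ (d + 1) * Real.pi ^ ((d : ℝ) / 2) * Real.Gamma (1 + (d : ℝ) / 4 + ε / 2)
    with hc_def
  have hc : 0 < c := by
    have := Real.Gamma_pos_of_pos (s := 1 + (d : ℝ) / 4 + ε / 2) (by positivity)
    positivity
  set b : ℝ := (1 + l ^ 2) / 4 with hb_def
  have hb : 0 < b := by positivity
  let G : ℕ → EuclideanSpace ℝ (Fin d) → ℝ := fun k x => ‖x‖ ^ k * Real.exp (-b * ‖x‖ ^ 2)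
  have hG (k : ℕ) : Integrable (G k) := integrable_norm_pow_mul_exp_neg_mul_sq hd hb k
  have expand (x : EuclideanSpace ℝ (Fin d)) : gfun d ε x * gfun d ε (l • x)
      = (4 * d ^ 2 / c ^ 2) * G 0 x - (8 * b * d / c ^ 2) * G 2 x + (l ^ 2 / c ^ 2) * G 4 x := by
    have hexp : Real.exp (-b * ‖x‖ ^ 2)
        = Real.exp (-‖x‖ ^ 2 / 4) * Real.exp (-‖l • x‖ ^ 2 / 4) := by
      rw [← Real.exp_add, norm_smul, mul_pow, Real.norm_eq_abs, sq_abs, hb_def]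
      congr 1
      ring
    have hnorm : ‖l • x‖ ^ 2 = l ^ 2 * ‖x‖ ^ 2 := by
      rw [norm_smul, mul_pow, Real.norm_eq_abs, sq_abs]
    simp only [gfun, ← hc_def, G]
    rw [hexp, hnorm, hb_def]
    field_simp
    ring
  have h0 : 0 < ∫ x, G 0 x := by
    have hpos (x : EuclideanSpace ℝ (Fin d)) : 0 < G 0 x := by positivity
    rw [integral_pos_iff_support_of_nonneg (fun x => (hpos x).le) (hG 0),
      Function.support_eq_univ (fun x => (hpos x).ne')]
    exact isOpen_univ.measure_pos volume univ_nonempty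
  have h2 : ∫ x, G 2 x = (d + (0 : ℕ)) / (2 * b) * ∫ x, G 0 x :=
    integral_norm_pow_add_two_mul_exp_neg_mul_sq hd hb 0
  have h4 : ∫ x, G 4 x = (d + (2 : ℕ)) / (2 * b) * ∫ x, G 2 x :=
    integral_norm_pow_add_two_mul_exp_neg_mul_sq hd hb 2
  simp_rw [expand]
  rw [integral_add (by exact ((hG 0).const_mul _).sub ((hG 2).const_mul _)) ((hG 4).const_mul _),
    integral_sub ((hG 0).const_mul _) ((hG 2).const_mul _), integral_const_mul, integral_const_mul,
    integral_const_mul, h4, h2]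
  have heq (I : ℝ) : 4 * (d : ℝ) ^ 2 / c ^ 2 * I
      - 8 * b * d / c ^ 2 * ((d + (0 : ℕ)) / (2 * b) * I)
      + l ^ 2 / c ^ 2 * ((d + (2 : ℕ)) / (2 * b) * ((d + (0 : ℕ)) / (2 * b) * I))
      = l ^ 2 / c ^ 2 * ((d + 2) / (2 * b) * (d / (2 * b) * I)) := by
    push_cast
    field_simp
    ring
  rw [heq]
  positivity

lemma integrable_gfun {d : ℕ} (hd : 1 ≤ d) (ε : ℝ) : Integrable (gfun d ε) := by
  have h0 := integrable_norm_pow_mul_exp_neg_mul_sq hd (b := 1 / 4) (by norm_num) 0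
  have h2 := integrable_norm_pow_mul_exp_neg_mul_sq hd (b := 1 / 4) (by norm_num) 2
  refine (((h0.const_mul (2 * (d : ℝ))).sub h2).div_const
    (2 ^ (d + 1) * Real.pi ^ ((d : ℝ) / 2) * Real.Gamma (1 + (d : ℝ) / 4 + ε / 2))).congr
    (.of_forall fun x => ?_)
  simp only [gfun, Pi.sub_apply]
  rw [show -(1 / 4) * ‖x‖ ^ 2 = -‖x‖ ^ 2 / 4 by ring]
  ring

lemma exists_norm_gfun_le (d : ℕ) (ε : ℝ) : ∃ C, ∀ x, ‖gfun d ε x‖ ≤ C := by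
  refine ⟨(2 * d + 4) / |2 ^ (d + 1) * Real.pi ^ ((d : ℝ) / 2)
    * Real.Gamma (1 + (d : ℝ) / 4 + ε / 2)|, fun x => ?_⟩
  have hle : |2 * (d : ℝ) - ‖x‖ ^ 2| * Real.exp (-‖x‖ ^ 2 / 4) ≤ 2 * d + 4 := by
    have h1 := Real.add_one_le_exp (‖x‖ ^ 2 / 4)
    have hd0 : (0 : ℝ) ≤ d := d.cast_nonneg
    have habs : |2 * (d : ℝ) - ‖x‖ ^ 2| ≤ 2 * d + ‖x‖ ^ 2 :=
      abs_le.2 ⟨by linarith, by nlinarith [sq_nonneg ‖x‖]⟩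
    rw [neg_div, Real.exp_neg, ← div_eq_mul_inv, div_le_iff₀ (Real.exp_pos _)]
    nlinarith [sq_nonneg ‖x‖]
  rw [gfun, Real.norm_eq_abs, abs_mul, abs_div, Real.abs_exp, div_mul_eq_mul_div]
  gcongr

/-- Positivity of `∫ g·p`, proved in the paper via Plancherel; this is what
guarantees the quartic coupling of the nontrivial fixed point is nonzero for `N ≠ 8`. -/
theorem stmt_7 (d : ℕ) (hd : 1 ≤ d) (ε : ℝ) (hε : 0 ≤ ε) (hε' : ε < (d:ℝ)/2) :
    0 < ∫ x : EuclideanSpace ℝ (Fin d), gfun d ε x * pfun d ε x := by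
  set a : ℝ := -1 + (d : ℝ) / 2 - ε with ha_def
  have ha : -1 < a := by linarith
  have hpow : Integrable (fun l : ℝ => l ^ a) (volume.restrict (Ioc 0 1)) :=
    (intervalIntegrable_iff_integrableOn_Ioc_of_le zero_le_one).1
      (intervalIntegral.intervalIntegrable_rpow' ha)
  obtain ⟨C, hC⟩ := exists_norm_gfun_le d ε
  have hint : Integrable (fun z : EuclideanSpace ℝ (Fin d) × ℝ =>
      gfun d ε z.1 * (z.2 ^ a * gfun d ε (z.2 • z.1)))
      (volume.prod (volume.restrict (Ioc 0 1))) := by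
    have hcont : Continuous fun z : EuclideanSpace ℝ (Fin d) × ℝ => gfun d ε (z.2 • z.1) :=
      (continuous_gfun d ε).comp (by fun_prop)
    simpa only [mul_assoc] using ((integrable_gfun hd ε).mul_prod hpow).mul_bdd (c := C)
      hcont.aestronglyMeasurable (.of_forall fun z => hC _)
  have hswap : ∫ x, gfun d ε x * pfun d ε x
      = ∫ l in (0 : ℝ)..1, ∫ x, gfun d ε x * (l ^ a * gfun d ε (l • x)) := by
    rw [intervalIntegral.integral_of_le zero_le_one, ← integral_integral_swap hint]
    simp only [pfun, ← ha_def, intervalIntegral.integral_of_le zero_le_one, integral_const_mul]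
  rw [hswap]
  refine intervalIntegral.intervalIntegral_pos_of_pos_on ?_ (fun l hl => ?_) zero_lt_one
  · exact (intervalIntegrable_iff_integrableOn_Ioc_of_le zero_le_one).2 hint.integral_prod_right
  · simp_rw [mul_left_comm _ (l ^ a)]
    rw [integral_const_mul]
    exact mul_pos (Real.rpow_pos_of_pos hl.1 a) (integral_gfun_mul_gfun_smul_pos hd hε hl.1)
end

section
/- For all finite sets P, Q, R of points of ℝ^d with Q nonempty, the Steiner diameter satisfies 𝒯(P ∪ Q ∪ R) ≤ 𝒯(P ∪ Q) + 𝒯(Q ∪ R). -/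
open scoped Classical

/-- The Steiner diameter (Appendix A of the paper): the infimum, over all finite
vertex sets `V ⊇ P` and all sets `E` of 2-element subsets (edges) of `V` such
that any two points of `P` are joined by a path of edges of `E`, of the total
edge length `∑_{{u,v} ∈ E} dist u v`. -/
noncomputable def steinerDiameter {d : ℕ} (P : Finset (EuclideanSpace ℝ (Fin d))) : ℝ :=
  sInf { L : ℝ |
    ∃ (V : Finset (EuclideanSpace ℝ (Fin d)))
      (E : Finset (Sym2 (EuclideanSpace ℝ (Fin d)))),
      P ⊆ V ∧
      (∀ e ∈ E, ¬ e.IsDiag ∧ ∀ x ∈ e, x ∈ V) ∧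
      (∀ x ∈ P, ∀ y ∈ P, Relation.ReflTransGen (fun u v => s(u, v) ∈ E) x y) ∧
      L = ∑ e ∈ E, Sym2.lift ⟨fun u v => dist u v, fun u v => dist_comm u v⟩ e }

/-- The length of an edge, i.e. the distance between its endpoints. -/
noncomputable def edgeLength {X : Type*} [PseudoMetricSpace X] : Sym2 X → ℝ :=
  Sym2.lift ⟨fun u v => dist u v, fun u v => dist_comm u v⟩

lemma edgeLength_nonneg {X : Type*} [PseudoMetricSpace X] (e : Sym2 X) : 0 ≤ edgeLength e := by
  induction e with
  | _ u v => exact dist_nonneg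

/-- The edge set `E` on the vertex set `V` joins all points of `P`. -/
def IsSteinerGraph {X : Type*} (P V : Finset X) (E : Finset (Sym2 X)) : Prop :=
  P ⊆ V ∧
  (∀ e ∈ E, ¬ e.IsDiag ∧ ∀ x ∈ e, x ∈ V) ∧
  ∀ x ∈ P, ∀ y ∈ P, Relation.ReflTransGen (fun u v => s(u, v) ∈ E) x y

lemma exists_isSteinerGraph {X : Type*} (P : Finset X) : ∃ V E, IsSteinerGraph P V E := by
  refine ⟨P, P.sym2.filter (fun e => ¬ e.IsDiag), subset_rfl, fun e he => ?_, fun x hx y hy => ?_⟩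
  · rw [Finset.mem_filter, Finset.mem_sym2_iff] at he
    exact ⟨he.2, he.1⟩
  · by_cases hxy : x = y
    · rw [hxy]
    · refine Relation.ReflTransGen.single ?_
      simp [hx, hy, hxy]

/-- Two Steiner graphs sharing a terminal glue to a Steiner graph for all terminals. -/
lemma IsSteinerGraph.union {X : Type*} [DecidableEq X] {P P' V V' : Finset X}
    {E E' : Finset (Sym2 X)}
    (h : IsSteinerGraph P V E) (h' : IsSteinerGraph P' V' E') {q : X} (hq : q ∈ P)
    (hq' : q ∈ P') : IsSteinerGraph (P ∪ P') (V ∪ V') (E ∪ E') := by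
  obtain ⟨hV, hE, hc⟩ := h
  obtain ⟨hV', hE', hc'⟩ := h'
  refine ⟨Finset.union_subset_union hV hV', fun e he => ?_, fun x hx y hy => ?_⟩
  · rcases Finset.mem_union.1 he with he | he
    · exact ⟨(hE e he).1, fun x hx => Finset.mem_union_left _ ((hE e he).2 x hx)⟩
    · exact ⟨(hE' e he).1, fun x hx => Finset.mem_union_right _ ((hE' e he).2 x hx)⟩
  · have hl {x y : X} (hx : x ∈ P) (hy : y ∈ P) :
        Relation.ReflTransGen (fun u v => s(u, v) ∈ E ∪ E') x y :=
      Relation.ReflTransGen.mono (fun _ _ => Finset.mem_union_left _) _ _ (hc x hx y hy)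
    have hr {x y : X} (hx : x ∈ P') (hy : y ∈ P') :
        Relation.ReflTransGen (fun u v => s(u, v) ∈ E ∪ E') x y :=
      Relation.ReflTransGen.mono (fun _ _ => Finset.mem_union_right _) _ _ (hc' x hx y hy)
    rcases Finset.mem_union.1 hx with hx | hx <;> rcases Finset.mem_union.1 hy with hy | hy
    · exact hl hx hy
    · exact (hl hx hq).trans (hr hq' hy)
    · exact (hr hx hq').trans (hl hq hy)
    · exact hr hx hy

lemma IsSteinerGraph.steinerDiameter_le {d : ℕ} {P V : Finset (EuclideanSpace ℝ (Fin d))}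
    {E : Finset (Sym2 (EuclideanSpace ℝ (Fin d)))} (h : IsSteinerGraph P V E) :
    steinerDiameter P ≤ ∑ e ∈ E, edgeLength e := by
  refine csInf_le ⟨0, ?_⟩ ⟨V, E, h.1, h.2.1, h.2.2, rfl⟩
  rintro _ ⟨V', E', -, -, -, rfl⟩
  exact Finset.sum_nonneg fun e _ => edgeLength_nonneg e

lemma le_steinerDiameter {d : ℕ} {P : Finset (EuclideanSpace ℝ (Fin d))} {a : ℝ}
    (h : ∀ V E, IsSteinerGraph P V E → a ≤ ∑ e ∈ E, edgeLength e) : a ≤ steinerDiameter P := by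
  obtain ⟨V, E, hVE⟩ := exists_isSteinerGraph P
  refine le_csInf ⟨_, V, E, hVE.1, hVE.2.1, hVE.2.2, rfl⟩ ?_
  rintro _ ⟨V', E', hV, hE, hc, rfl⟩
  exact h V' E' ⟨hV, hE, hc⟩

lemma sum_edgeLength_union_le {X : Type*} [PseudoMetricSpace X] [DecidableEq X]
    (E E' : Finset (Sym2 X)) :
    ∑ e ∈ E ∪ E', edgeLength e ≤ ∑ e ∈ E, edgeLength e + ∑ e ∈ E', edgeLength e := by
  rw [← Finset.sum_union_inter]
  exact le_add_of_nonneg_right (Finset.sum_nonneg fun e _ => edgeLength_nonneg e)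

/-- Subadditivity of the Steiner diameter (property (3) of Appendix A of the paper). -/
theorem stmt_10 {d : ℕ} (P Q R : Finset (EuclideanSpace ℝ (Fin d))) (hQ : Q.Nonempty) :
    steinerDiameter (P ∪ Q ∪ R) ≤ steinerDiameter (P ∪ Q) + steinerDiameter (Q ∪ R) := by
  obtain ⟨q, hq⟩ := hQ
  rw [← sub_le_iff_le_add]
  refine le_steinerDiameter fun V E h => ?_
  rw [sub_le_comm]
  refine le_steinerDiameter fun V' E' h' => ?_
  rw [sub_le_iff_le_add']
  have hPQR : P ∪ Q ∪ R = P ∪ Q ∪ (Q ∪ R) := by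
    ext x
    simp only [Finset.mem_union]
    tauto
  rw [hPQR]
  exact (h.union h' (Finset.mem_union_right _ hq)
    (Finset.mem_union_left _ hq)).steinerDiameter_le.trans (sum_edgeLength_union_le E E')
end

section
/- Let a₀ > 0, A₁ ≥ 0, b₀ ≠ 0, C₁ ≥ 0, C₂ ≥ 0, C₃ ≥ 0, and ε₁ > 0 be real numbers. Suppose that for each ε ∈ (0, ε₁] we are given real numbers a_ε, A_ε, b_ε with a_ε ≥ a₀, |A_ε| ≤ A₁, |b_ε − b₀| ≤ C₃·ε, and functions B₁^ε, B₂^ε : ℝ × ℝ → ℝ satisfying, for all (ν, λ), (ν', λ') ∈ ℝ² and i ∈ {1,2}: |B_i^ε(ν, λ)| ≤ C₁·(|ν| + |λ|)³ and |B_i^ε(ν, λ) − B_i^ε(ν', λ')| ≤ C₂·(|ν| + |λ| + |ν'| + |λ'|)²·(|ν − ν'| + |λ − λ'|). Then there exist ε₀ ∈ (0, ε₁] and K ≥ 0 such that for every ε ∈ (0, ε₀] there exist real numbers ν̃, λ with a_ε·ν̃ = −A_ε·λ² + B₁^ε(ν̃, λ) and 2ε·λ = b_ε·λ² + B₂^ε(ν̃,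 λ), satisfying λ ≠ 0, |λ − 2ε/b₀| ≤ K·ε², and |ν̃| ≤ K·ε². -/
/-- A half-contraction of a closed ball of the plane around the origin has a fixed point there. -/
theorem exists_fixedPoint_of_half_contraction {T : ℝ × ℝ → ℝ × ℝ} {r : ℝ} (hr : 0 ≤ r)
    (hmaps : ∀ p, ‖p‖ ≤ r → ‖T p‖ ≤ r)
    (hlip : ∀ p q, ‖p‖ ≤ r → ‖q‖ ≤ r → ‖T p - T q‖ ≤ 1 / 2 * ‖p - q‖) :
    ∃ p, ‖p‖ ≤ r ∧ T p = p := by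
  have hmaps' : Set.MapsTo T (Metric.closedBall 0 r) (Metric.closedBall 0 r) := by
    intro p hp
    rw [mem_closedBall_zero_iff] at hp ⊢
    exact hmaps p hp
  have hcontr : ContractingWith (1 / 2) (hmaps'.restrict T _ _) := by
    refine ⟨by norm_num, LipschitzWith.of_dist_le_mul ?_⟩
    rintro ⟨p, hp⟩ ⟨q, hq⟩
    rw [mem_closedBall_zero_iff] at hp hq
    simpa [Subtype.dist_eq, dist_eq_norm] using hlip p q hp hq
  obtain ⟨p, hp, hfix, -⟩ := hcontr.exists_fixedPoint' Metric.isClosed_closedBall.isComplete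
    hmaps' (x := 0) (Metric.mem_closedBall_self hr) (edist_ne_top _ _)
  exact ⟨p, mem_closedBall_zero_iff.mp hp, hfix⟩

/-- A function of cubic size, rescaled by `ε` in its arguments and by `ε⁻²` in its values,
is of size `ε` on bounded sets. -/
theorem abs_rescaled_le {B : ℝ → ℝ → ℝ} {C M ε : ℝ} (hC : 0 ≤ C) (hε : 0 < ε)
    (hB : ∀ ν l, |B ν l| ≤ C * (|ν| + |l|) ^ 3) {z y : ℝ} (h : |z| + |y| ≤ M) :
    |B (ε * z) (ε * y) / ε ^ 2| ≤ ε * (C * M ^ 3) := by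
  rw [abs_div, abs_of_pos (pow_pos hε 2), div_le_iff₀ (pow_pos hε 2)]
  calc |B (ε * z) (ε * y)| ≤ C * (|ε * z| + |ε * y|) ^ 3 := hB _ _
    _ = C * (|z| + |y|) ^ 3 * ε ^ 3 := by rw [abs_mul, abs_mul, abs_of_pos hε]; ring
    _ ≤ C * M ^ 3 * ε ^ 3 := by gcongr
    _ = ε * (C * M ^ 3) * ε ^ 2 := by ring

/-- A function with quadratically small Lipschitz constant, rescaled by `ε` in its arguments
and by `ε⁻²` in its values, has Lipschitz constant of order `ε` on bounded sets. -/
theorem abs_rescaled_sub_le {B : ℝ → ℝ → ℝ} {C M ε : ℝ} (hC : 0 ≤ C) (hε : 0 < ε)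
    (hB : ∀ ν l ν' l', |B ν l - B ν' l'|
      ≤ C * (|ν| + |l| + |ν'| + |l'|) ^ 2 * (|ν - ν'| + |l - l'|))
    {z y z' y' : ℝ} (h : |z| + |y| ≤ M) (h' : |z'| + |y'| ≤ M) :
    |B (ε * z) (ε * y) / ε ^ 2 - B (ε * z') (ε * y') / ε ^ 2|
      ≤ ε * (4 * C * M ^ 2) * (|z - z'| + |y - y'|) := by
  rw [← sub_div, abs_div, abs_of_pos (pow_pos hε 2), div_le_iff₀ (pow_pos hε 2)]
  calc |B (ε * z) (ε * y) - B (ε * z') (ε * y')|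
      ≤ C * (|ε * z| + |ε * y| + |ε * z'| + |ε * y'|) ^ 2
          * (|ε * z - ε * z'| + |ε * y - ε * y'|) := hB _ _ _ _
    _ = C * (|z| + |y| + |z'| + |y'|) ^ 2 * (|z - z'| + |y - y'|) * ε ^ 3 := by
        simp only [← mul_sub, abs_mul, abs_of_pos hε]; ring
    _ ≤ C * (2 * M) ^ 2 * (|z - z'| + |y - y'|) * ε ^ 3 := by
        gcongr
        linarith
    _ = ε * (4 * C * M ^ 2) * (|z - z'| + |y - y'|) * ε ^ 2 := by ring

theorem abs_sq_sub_sq_le {x y M : ℝ} (hx : |x| ≤ M) (hy : |y| ≤ M) :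
    |x ^ 2 - y ^ 2| ≤ 2 * M * |x - y| := by
  rw [sq_sub_sq, abs_mul]
  gcongr
  linarith [abs_add_le x y]

theorem abs_sq_le_of_abs_le {x M : ℝ} (hx : |x| ≤ M) : |x ^ 2| ≤ M ^ 2 := by
  rw [abs_pow]
  gcongr

/-- The fixed point equations in rescaled variables, with `t` the deviation of the second
variable from its leading value `c`. -/
theorem exists_rescaled_fixedPoint {a₀ A₁ b₀ C₃ c P Q K L M ε a A b : ℝ} {β₁ β₂ : ℝ → ℝ → ℝ}
    (ha₀ : 0 < a₀) (hA₁ : 0 ≤ A₁) (hC₃ : 0 ≤ C₃) (hP : 0 ≤ P) (hQ : 0 ≤ Q)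
    (hM : M = |c| + 2)
    (hK : K = (A₁ * M ^ 2 + P) / a₀ + C₃ * M ^ 2 + P)
    (hL : L = (2 * A₁ * M + 2 * Q) / a₀ + |b₀| * K + C₃ * M + Q)
    (hε : 0 < ε) (hεKL : ε * (1 + K + 2 * L) ≤ 1)
    (ha : a₀ ≤ a) (hA : |A| ≤ A₁) (hb : |b - b₀| ≤ C₃ * ε)
    (hβ₁ : ∀ z y, |z| + |y| ≤ M → |β₁ z y| ≤ ε * P)
    (hβ₂ : ∀ z y, |z| + |y| ≤ M → |β₂ z y| ≤ ε * P)
    (hβ₁' : ∀ z y z' y', |z| + |y| ≤ M → |z'| + |y'| ≤ M →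
      |β₁ z y - β₁ z' y'| ≤ ε * Q * (|z - z'| + |y - y'|))
    (hβ₂' : ∀ z y z' y', |z| + |y| ≤ M → |z'| + |y'| ≤ M →
      |β₂ z y - β₂ z' y'| ≤ ε * Q * (|z - z'| + |y - y'|)) :
    ∃ z t : ℝ, |z| ≤ K * ε ∧ |t| ≤ K * ε ∧
      a * z = ε * (β₁ z (c + t) - A * (c + t) ^ 2) ∧
      2 * t = -(b₀ * t ^ 2 + (b - b₀) * (c + t) ^ 2 + β₂ z (c + t)) := by
  have ha' : 0 < a := ha₀.trans_le ha
  have hM0 : 0 ≤ M := by rw [hM]; positivity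
  have hK0 : 0 ≤ K := by rw [hK]; positivity
  have hR1 : 0 ≤ (2 * A₁ * M + 2 * Q) / a₀ := by positivity
  have hR2 : 0 ≤ |b₀| * K := by positivity
  have hR3 : 0 ≤ C₃ * M := by positivity
  have hL0 : 0 ≤ L := by rw [hL]; positivity
  have hεK : 0 ≤ ε * K := by positivity
  have hεL : 0 ≤ ε * L := by positivity
  have hε1 : ε ≤ 1 := by linarith
  have hεK1 : K * ε ≤ 1 := by linarith
  have hεL1 : ε * L ≤ 1 / 2 := by linarith
  have hsize : ∀ p : ℝ × ℝ, ‖p‖ ≤ K * ε →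
      |p.1| ≤ K * ε ∧ |p.2| ≤ K * ε ∧ |p.1| + |c + p.2| ≤ M ∧ |c + p.2| ≤ M := by
    intro p hp
    obtain ⟨h1, h2⟩ := norm_prod_le_iff.mp hp
    rw [Real.norm_eq_abs] at h1 h2
    have := abs_add_le c p.2
    exact ⟨h1, h2, by linarith, by linarith [abs_nonneg p.1]⟩
  let T : ℝ × ℝ → ℝ × ℝ := fun p => (ε * (β₁ p.1 (c + p.2) - A * (c + p.2) ^ 2) / a,
    -(b₀ * p.2 ^ 2 + (b - b₀) * (c + p.2) ^ 2 + β₂ p.1 (c + p.2)) / 2)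
  suffices hT : ∃ p, ‖p‖ ≤ K * ε ∧ T p = p by
    obtain ⟨p, hp, hfix⟩ := hT
    obtain ⟨h1, h2, -⟩ := hsize p hp
    refine ⟨p.1, p.2, h1, h2, ?_, ?_⟩
    · have := congrArg Prod.fst hfix
      simp only [T] at this
      rw [div_eq_iff ha'.ne'] at this
      linarith
    · have := congrArg Prod.snd hfix
      simp only [T] at this
      linarith
  refine exists_fixedPoint_of_half_contraction (by positivity) ?_ ?_
  · intro p hp
    obtain ⟨-, h2, h3, h4⟩ := hsize p hp
    have hy := abs_sq_le_of_abs_le h4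
    refine norm_prod_le_iff.mpr ⟨?_, ?_⟩ <;> rw [Real.norm_eq_abs]
    · rw [abs_div, abs_mul, abs_of_pos hε, abs_of_pos ha']
      calc ε * |β₁ p.1 (c + p.2) - A * (c + p.2) ^ 2| / a
          ≤ ε * (A₁ * M ^ 2 + P) / a₀ := by
            gcongr
            refine (abs_sub _ _).trans ?_
            rw [abs_mul]
            have : |A| * |(c + p.2) ^ 2| ≤ A₁ * M ^ 2 := by gcongr
            have := hβ₁ _ _ h3
            nlinarith
        _ = (A₁ * M ^ 2 + P) / a₀ * ε := by ring
        _ ≤ K * ε := by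
            gcongr
            have : 0 ≤ C₃ * M ^ 2 := by positivity
            linarith
    · have e1 : |b₀ * p.2 ^ 2| ≤ K * ε := by
        rw [abs_mul]
        have := abs_sq_le_of_abs_le h2
        calc |b₀| * |p.2 ^ 2| ≤ |b₀| * (K * ε) ^ 2 := by gcongr
          _ = (ε * (|b₀| * K)) * (K * ε) := by ring
          _ ≤ 1 * (K * ε) := by
            gcongr
            have : ε * (|b₀| * K) ≤ ε * L := by gcongr; linarith
            linarith
          _ = K * ε := one_mul _
      have e2 : |(b - b₀) * (c + p.2) ^ 2| ≤ C₃ * ε * M ^ 2 := by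
        rw [abs_mul]; gcongr
      have e3 := hβ₂ _ _ h3
      have e4 : (C₃ * M ^ 2 + P) * ε ≤ K * ε := by
        gcongr
        have : 0 ≤ (A₁ * M ^ 2 + P) / a₀ := by positivity
        linarith
      rw [abs_div, abs_neg, abs_two]
      have := abs_add_three (b₀ * p.2 ^ 2) ((b - b₀) * (c + p.2) ^ 2) (β₂ p.1 (c + p.2))
      linarith
  · intro p q hp hq
    obtain ⟨-, hp2, hp3, hp4⟩ := hsize p hp
    obtain ⟨-, hq2, hq3, hq4⟩ := hsize q hq
    have hd1 : |p.1 - q.1| ≤ ‖p - q‖ := norm_fst_le (p - q)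
    have hd2 : |p.2 - q.2| ≤ ‖p - q‖ := norm_snd_le (p - q)
    generalize ‖p - q‖ = d at hd1 hd2
    have hd : 0 ≤ d := (abs_nonneg _).trans hd1
    have hadd : (c + p.2) - (c + q.2) = p.2 - q.2 := by ring
    have hy := abs_sq_sub_sq_le hp4 hq4
    have h1 := hβ₁' _ _ _ _ hp3 hq3
    have h2 := hβ₂' _ _ _ _ hp3 hq3
    rw [hadd] at hy h1 h2
    have hy' : |(c + p.2) ^ 2 - (c + q.2) ^ 2| ≤ 2 * M * d := hy.trans (by gcongr)
    have hsum : ε * Q * (|p.1 - q.1| + |p.2 - q.2|) ≤ ε * Q * (2 * d) := by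
      gcongr
      linarith
    have hLd : ε * L * d ≤ 1 / 2 * d := by gcongr
    refine norm_prod_le_iff.mpr ⟨?_, ?_⟩ <;> rw [Real.norm_eq_abs] <;> refine le_trans ?_ hLd
    · have e : ε * (β₁ p.1 (c + p.2) - A * (c + p.2) ^ 2) / a
          - ε * (β₁ q.1 (c + q.2) - A * (c + q.2) ^ 2) / a
          = ε * ((β₁ p.1 (c + p.2) - β₁ q.1 (c + q.2))
            - A * ((c + p.2) ^ 2 - (c + q.2) ^ 2)) / a := by ring
      simp only [T, Prod.fst_sub]
      rw [e, abs_div, abs_mul, abs_of_pos hε, abs_of_pos ha']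
      calc _ ≤ ε * ((2 * A₁ * M + 2 * Q) * d) / a₀ := by
            gcongr
            refine (abs_sub _ _).trans ?_
            rw [abs_mul]
            have e1 : |A| * |(c + p.2) ^ 2 - (c + q.2) ^ 2| ≤ A₁ * (2 * M * d) := by gcongr
            have e2 : ε * (Q * (2 * d)) ≤ 1 * (Q * (2 * d)) := by gcongr
            linarith
        _ = ε * ((2 * A₁ * M + 2 * Q) / a₀) * d := by ring
        _ ≤ ε * L * d := by gcongr; linarith
    · have e : -(b₀ * p.2 ^ 2 + (b - b₀) * (c + p.2) ^ 2 + β₂ p.1 (c + p.2)) / 2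
          - -(b₀ * q.2 ^ 2 + (b - b₀) * (c + q.2) ^ 2 + β₂ q.1 (c + q.2)) / 2
          = -(b₀ * (p.2 ^ 2 - q.2 ^ 2) + (b - b₀) * ((c + p.2) ^ 2 - (c + q.2) ^ 2)
            + (β₂ p.1 (c + p.2) - β₂ q.1 (c + q.2))) / 2 := by ring
      simp only [T, Prod.snd_sub]
      rw [e, abs_div, abs_neg, abs_two]
      have e1 : |b₀ * (p.2 ^ 2 - q.2 ^ 2)| ≤ |b₀| * (2 * (K * ε) * d) := by
        rw [abs_mul]
        gcongr
        exact (abs_sq_sub_sq_le hp2 hq2).trans (by gcongr)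
      have e2 : |(b - b₀) * ((c + p.2) ^ 2 - (c + q.2) ^ 2)| ≤ C₃ * ε * (2 * M * d) := by
        rw [abs_mul]; gcongr
      have e3 := abs_add_three (b₀ * (p.2 ^ 2 - q.2 ^ 2))
        ((b - b₀) * ((c + p.2) ^ 2 - (c + q.2) ^ 2)) (β₂ p.1 (c + p.2) - β₂ q.1 (c + q.2))
      have e4 : ε * (|b₀| * K + C₃ * M + Q) * d ≤ ε * L * d := by gcongr; linarith
      linarith


/-- The abstract ε-expansion fixed point claim of Section 2 of the paper
(equations (2.23)–(2.26)): the exact fixed point equations for the local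
relevant couplings `(ν̃, λ)` — the truncated second-order equations plus error
terms `B₁, B₂` satisfying a cubic smallness bound and a quadratic Lipschitz
bound uniformly in `ε` — admit a nontrivial (`λ ≠ 0`) solution with
`λ = 2ε/b₀ + O(ε²)` and `ν̃ = O(ε²)` for all sufficiently small `ε > 0`. -/
theorem stmt_16 (a₀ A₁ b₀ C₁ C₂ C₃ ε₁ : ℝ)
    (ha₀ : 0 < a₀) (hA₁ : 0 ≤ A₁) (hb₀ : b₀ ≠ 0) (hC₁ : 0 ≤ C₁) (hC₂ : 0 ≤ C₂)
    (hC₃ : 0 ≤ C₃) (hε₁ : 0 < ε₁)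
    (a A b : ℝ → ℝ) (B₁ B₂ : ℝ → ℝ → ℝ → ℝ)
    (ha : ∀ ε ∈ Set.Ioc (0:ℝ) ε₁, a₀ ≤ a ε)
    (hA : ∀ ε ∈ Set.Ioc (0:ℝ) ε₁, |A ε| ≤ A₁)
    (hb : ∀ ε ∈ Set.Ioc (0:ℝ) ε₁, |b ε - b₀| ≤ C₃ * ε)
    (hB₁_small : ∀ ε ∈ Set.Ioc (0:ℝ) ε₁, ∀ ν lam : ℝ,
      |B₁ ε ν lam| ≤ C₁ * (|ν| + |lam|)^3)
    (hB₂_small : ∀ ε ∈ Set.Ioc (0:ℝ) ε₁, ∀ ν lam : ℝ,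
      |B₂ ε ν lam| ≤ C₁ * (|ν| + |lam|)^3)
    (hB₁_lip : ∀ ε ∈ Set.Ioc (0:ℝ) ε₁, ∀ ν lam ν' lam' : ℝ,
      |B₁ ε ν lam - B₁ ε ν' lam'|
        ≤ C₂ * (|ν| + |lam| + |ν'| + |lam'|)^2 * (|ν - ν'| + |lam - lam'|))
    (hB₂_lip : ∀ ε ∈ Set.Ioc (0:ℝ) ε₁, ∀ ν lam ν' lam' : ℝ,
      |B₂ ε ν lam - B₂ ε ν' lam'|
        ≤ C₂ * (|ν| + |lam| + |ν'| + |lam'|)^2 * (|ν - ν'| + |lam - lam'|)) :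
    ∃ ε₀ ∈ Set.Ioc (0:ℝ) ε₁, ∃ K : ℝ, 0 ≤ K ∧
      ∀ ε ∈ Set.Ioc (0:ℝ) ε₀, ∃ ν lam : ℝ,
        a ε * ν = -(A ε) * lam^2 + B₁ ε ν lam ∧
        2 * ε * lam = b ε * lam^2 + B₂ ε ν lam ∧
        lam ≠ 0 ∧
        |lam - 2*ε/b₀| ≤ K * ε^2 ∧
        |ν| ≤ K * ε^2 := by
  obtain ⟨M, hM⟩ : ∃ M, M = |2 / b₀| + 2 := ⟨_, rfl⟩
  have hM0 : 0 ≤ M := by rw [hM]; positivity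
  obtain ⟨P, hP⟩ : ∃ P, P = C₁ * M ^ 3 := ⟨_, rfl⟩
  have hP0 : 0 ≤ P := by rw [hP]; positivity
  obtain ⟨Q, hQ⟩ : ∃ Q, Q = 4 * C₂ * M ^ 2 := ⟨_, rfl⟩
  have hQ0 : 0 ≤ Q := by rw [hQ]; positivity
  obtain ⟨K, hK⟩ : ∃ K, K = (A₁ * M ^ 2 + P) / a₀ + C₃ * M ^ 2 + P := ⟨_, rfl⟩
  have hK0 : 0 ≤ K := by rw [hK]; positivity
  obtain ⟨L, hL⟩ : ∃ L, L = (2 * A₁ * M + 2 * Q) / a₀ + |b₀| * K + C₃ * M + Q := ⟨_, rfl⟩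
  have hL0 : 0 ≤ L := by rw [hL]; positivity
  have hbK : |b₀| * K ≤ L := by
    have h1 : 0 ≤ (2 * A₁ * M + 2 * Q) / a₀ := by positivity
    have h2 : 0 ≤ C₃ * M := by positivity
    linarith
  have hS : 0 < 1 + K + 2 * L := by positivity
  refine ⟨min ε₁ (1 / (1 + K + 2 * L)), ⟨by positivity, min_le_left _ _⟩, K, hK0, ?_⟩
  rintro ε ⟨hε, hεle⟩
  have hmem : ε ∈ Set.Ioc (0 : ℝ) ε₁ := ⟨hε, hεle.trans (min_le_left _ _)⟩
  have hεS : ε * (1 + K + 2 * L) ≤ 1 :=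
    (le_div_iff₀ hS).mp (hεle.trans (min_le_right _ _))
  obtain ⟨z, t, hz, ht, eq₁, eq₂⟩ := exists_rescaled_fixedPoint (c := 2 / b₀)
    (β₁ := fun z y => B₁ ε (ε * z) (ε * y) / ε ^ 2)
    (β₂ := fun z y => B₂ ε (ε * z) (ε * y) / ε ^ 2)
    ha₀ hA₁ hC₃ hP0 hQ0 hM hK hL hε hεS (ha ε hmem) (hA ε hmem) (hb ε hmem)
    (fun z y h => hP ▸ abs_rescaled_le hC₁ hε (hB₁_small ε hmem) h)
    (fun z y h => hP ▸ abs_rescaled_le hC₁ hε (hB₂_small ε hmem) h)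
    (fun z y z' y' h h' => hQ ▸ abs_rescaled_sub_le hC₂ hε (hB₁_lip ε hmem) h h')
    (fun z y z' y' h h' => hQ ▸ abs_rescaled_sub_le hC₂ hε (hB₂_lip ε hmem) h h')
  have hc : b₀ * (2 / b₀) = 2 := mul_div_cancel₀ 2 hb₀
  have hdev : ε * (2 / b₀ + t) - 2 * ε / b₀ = ε * t := by ring
  have hscale : ∀ x : ℝ, |x| ≤ K * ε → |ε * x| ≤ K * ε ^ 2 := by
    intro x hx
    rw [abs_mul, abs_of_pos hε]
    nlinarith
  refine ⟨ε * z, ε * (2 / b₀ + t), ?_, ?_, ?_, ?_, hscale z hz⟩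
  · field_simp at eq₁ ⊢
    linarith
  · generalize 2 / b₀ = c at *
    generalize B₂ ε (ε * z) (ε * (c + t)) = w at *
    have hw : w = w / ε ^ 2 * ε ^ 2 := by field_simp
    rw [hw]
    linear_combination -ε ^ 2 * eq₂ - ε ^ 2 * (c + t) * hc - ε ^ 2 * t * hc
  · refine mul_ne_zero hε.ne' fun h => ?_
    have hbt : |b₀ * t| = 2 := by
      rw [eq_neg_of_add_eq_zero_right h, mul_neg, hc, abs_neg, abs_two]
    have h1 : |b₀ * t| ≤ |b₀| * (K * ε) := by rw [abs_mul]; gcongr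
    have h2 : ε * (|b₀| * K) ≤ ε * L := by gcongr
    have h3 : 0 ≤ ε * K := by positivity
    have h4 : 0 ≤ ε * L := by positivity
    linarith
  · rw [hdev]
    exact hscale t ht
end
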